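/- Under the standing assumptions, let c be a codeword of C_{n−1}(n,q) with wt(c) ≤ W(n,q), let k satisfy 1 ≤ k ≤ n−1, and let κ be a k-space of PG(n,q) with the following property: for every j with 1 ≤ j ≤ k−1 and every j-space γ contained in κ that is thin with respect to c, writing wt_γ for the number of points of supp(c) lying in γ, there exist exactly ⌈wt_γ/θ_{j−1}⌉ pairwise distinct (j−1)-spaces contained in γ and nonzero scalars in ℤ/pℤ whose linear combination of indicator functions agrees with c at every point of γ. Then κ is either thin or thick with respect to c. -/

import Mathlib

open Module

noncomputable section

/-- `pgTheta q m = 1 + q + … + q^m` for `m ≥ 0`, and `0` for `m < 0`. -/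
def pgTheta (q : ℕ) (m : ℤ) : ℤ := ∑ i ∈ Finset.range (m + 1).toNat, (q : ℤ) ^ i

/-- `q^j`, truncated to `0` for negative exponents `j`. -/
def pgQpow (q : ℕ) (j : ℤ) : ℤ := if j < 0 then 0 else (q : ℤ) ^ j.toNat

/-- `Δ_{i,q}` where `q = p^h`: `⌊√q / 2^(i-2)⌋` if `h > 2`, and `⌊p / 2^i⌋` if `h = 2`. -/
noncomputable def pgDelta (p h : ℕ) (i : ℤ) : ℤ :=
  if 2 < h then ⌊Real.sqrt ((p : ℝ) ^ h) / (2 : ℝ) ^ (i - 2)⌋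
  else ⌊(p : ℝ) / (2 : ℝ) ^ i⌋

/-- `W(i,q) = (Δ_{i,q} - 1)·θ_{i-1}`. -/
noncomputable def pgW (p h : ℕ) (i : ℤ) : ℤ := (pgDelta p h i - 1) * pgTheta (p ^ h) (i - 1)

/-- `U(n,i,q) = q^i − (Δ_{n,q} − 2)·⌊q^(i−1)⌋ − (i−2)·((q−1)·Δ_{n,q} + 1)·⌊q^(i−3)⌋ + θ_{i−3}`. -/
noncomputable def pgU (p h n : ℕ) (i : ℤ) : ℤ :=
  pgQpow (p ^ h) i - (pgDelta p h n - 2) * pgQpow (p ^ h) (i - 1)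
    - (i - 2) * ((((p ^ h : ℕ) : ℤ) - 1) * pgDelta p h n + 1) * pgQpow (p ^ h) (i - 3)
    + pgTheta (p ^ h) (i - 3)

/-- `⌈w / θ_m⌉` as a natural number. -/
noncomputable def pgCeil (q w : ℕ) (m : ℤ) : ℕ := (⌈(w : ℚ) / ((pgTheta q m : ℤ) : ℚ)⌉).toNat
open scoped Classical

/-- A point of `PG(n,q)`: a 1-dimensional subspace of `F^(n+1)`. -/
abbrev PGPoint (F : Type) [Field F] (n : ℕ) :=
  {P : Submodule F (Fin (n + 1) → F) // finrank F P = 1}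

/-- The indicator function of a subspace `κ`, with values in `ZMod p`. -/
noncomputable def pgInd (p : ℕ) (F : Type) [Field F] (n : ℕ)
    (κ : Submodule F (Fin (n + 1) → F)) : PGPoint F n → ZMod p :=
  fun P => if P.1 ≤ κ then 1 else 0

/-- The code `C_{n-1}(n,q)`: the `ZMod p`-span of the indicator functions of all
hyperplanes (i.e. `n`-dimensional subspaces of `F^(n+1)`). -/
noncomputable def pgCode (p : ℕ) (F : Type) [Field F] (n : ℕ) :
    Submodule (ZMod p) (PGPoint F n → ZMod p) :=
  Submodule.span (ZMod p)
    {f | ∃ H : Submodule F (Fin (n + 1) → F), finrank F H = n ∧ f = pgInd p F n H}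

/-- The weight of a codeword: the number of points where it is nonzero. -/
noncomputable def pgWt (p : ℕ) (F : Type) [Field F] (n : ℕ)
    (c : PGPoint F n → ZMod p) : ℕ :=
  Set.ncard {P : PGPoint F n | c P ≠ 0}

/-- The number of points of `supp c` lying in the subspace `κ`. -/
noncomputable def pgSecant (p : ℕ) (F : Type) [Field F] (n : ℕ)
    (c : PGPoint F n → ZMod p) (κ : Submodule F (Fin (n + 1) → F)) : ℕ :=
  Set.ncard {P : PGPoint F n | c P ≠ 0 ∧ P.1 ≤ κ}

/-- A codeword `c` is minimal if every codeword whose support is contained in the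
support of `c` is a scalar multiple of `c`. -/
noncomputable def pgMinimal (p : ℕ) (F : Type) [Field F] (n : ℕ)
    (c : PGPoint F n → ZMod p) : Prop :=
  ∀ c' ∈ pgCode p F n, {P : PGPoint F n | c' P ≠ 0} ⊆ {P : PGPoint F n | c P ≠ 0} →
    ∃ α : ZMod p, c' = α • c

/-- A function on the affine plane over `F` has polynomial moments if, for every `t`, its `t`-th
moment along vertical lines is a polynomial of degree at most `t` in the abscissa. -/
def HasPolyMoments {F : Type} [Field F] [Fintype F] (f : F → F → F) : Prop :=
  ∀ t : ℕ, ∃ A : Polynomial F, A.natDegree ≤ t ∧ ∀ m, A.eval m = ∑ b, f m b * b ^ t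

section Moments

open Polynomial

variable {F : Type} [Field F] [Fintype F]

theorem HasPolyMoments.add {f g : F → F → F} (hf : HasPolyMoments f) (hg : HasPolyMoments g) :
    HasPolyMoments (f + g) := by
  intro t
  obtain ⟨A, hA, hA'⟩ := hf t
  obtain ⟨B, hB, hB'⟩ := hg t
  refine ⟨A + B, natDegree_add_le_of_degree_le hA hB, fun m => ?_⟩
  simp [hA', hB', add_mul, Finset.sum_add_distrib]

theorem HasPolyMoments.smul {f : F → F → F} (hf : HasPolyMoments f) (a : F) :
    HasPolyMoments (a • f) := by
  intro t
  obtain ⟨A, hA, hA'⟩ := hf t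
  refine ⟨C a * A, (natDegree_C_mul_le _ _).trans hA, fun m => ?_⟩
  simp [hA', Finset.mul_sum, mul_assoc]

theorem HasPolyMoments.zero : HasPolyMoments (0 : F → F → F) :=
  fun t => ⟨0, by simp, by simp⟩

/-- The indicator function of a non-vertical line has polynomial moments. -/
theorem hasPolyMoments_graph (α β : F) :
    HasPolyMoments (fun m b : F => if b = α * m + β then (1 : F) else 0) := by
  intro t
  refine ⟨(C α * X + C β) ^ t, ?_, fun m => by simp⟩
  refine natDegree_pow_le.trans ?_
  calc t * (C α * X + C β).natDegree ≤ t * 1 := Nat.mul_le_mul_left _ natDegree_linear_le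
    _ = t := mul_one t

/-- A function that is constant on each vertical line has polynomial moments. -/
theorem hasPolyMoments_vertical (g : F → F) : HasPolyMoments (fun m _ : F => g m) := by
  intro t
  by_cases ht : t < Fintype.card F - 1
  · refine ⟨0, by simp, fun m => ?_⟩
    simp [← Finset.mul_sum, FiniteField.sum_pow_lt_card_sub_one F t ht]
  · refine ⟨C (∑ b : F, b ^ t) * Lagrange.interpolate Finset.univ id g, ?_, fun m => ?_⟩
    · refine (natDegree_C_mul_le _ _).trans ?_
      have := Lagrange.degree_interpolate_le (s := Finset.univ) (v := id) g
        (Function.injective_id.injOn)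
      exact (natDegree_le_of_degree_le this).trans (by simpa using ht)
    · have := Lagrange.eval_interpolate_at_node (s := Finset.univ) (v := id) g
        (Function.injective_id.injOn) (Finset.mem_univ m)
      rw [id] at this
      rw [eval_mul, eval_C, this, ← Finset.mul_sum, mul_comm]

theorem natDegree_hankel_det_le {F : Type} [Field F] {s : ℕ} (A : ℕ → F[X])
    (hA : ∀ t, (A t).natDegree ≤ t) :
    (Matrix.of fun i j : Fin s => A (i + j)).det.natDegree ≤ s * (s - 1) := by
  rw [Matrix.det_apply]
  refine natDegree_sum_le_of_forall_le _ _ fun σ _ => ?_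
  refine (natDegree_smul_le _ _).trans ?_
  refine (natDegree_prod_le _ _).trans ?_
  calc ∑ i : Fin s, (Matrix.of (fun i j : Fin s => A (i + j)) (σ i) i).natDegree
      ≤ ∑ i : Fin s, ((σ i : ℕ) + i) := Finset.sum_le_sum fun i _ => hA _
    _ = s * (s - 1) := by
      rw [Finset.sum_add_distrib, Equiv.sum_comp σ (fun i : Fin s => (i : ℕ)),
        Fin.sum_univ_eq_sum_range (fun i => i) s, ← mul_two, Finset.sum_range_id_mul_two]

/-- The Hankel determinant of the moments vanishes at `m` with multiplicity at least the defect of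
the support of `f m`. -/
theorem pow_dvd_hankel_det {s : ℕ} (f : F → F → F) (A : ℕ → F[X])
    (hA : ∀ t m, (A t).eval m = ∑ b, f m b * b ^ t) (m : F) :
    (X - C m) ^ (s - (Finset.univ.filter fun b => f m b ≠ 0).card) ∣
      (Matrix.of fun i j : Fin s => A (i + j)).det := by
  set S := Finset.univ.filter fun b => f m b ≠ 0 with hS
  set g : F[X] := ∏ b ∈ S, (X - C b) with hg
  have hgm : g.Monic := monic_prod_of_monic _ _ fun b _ => monic_X_sub_C b
  have hgd : g.natDegree = S.card := by
    rw [hg, natDegree_prod_of_monic _ _ fun b _ => monic_X_sub_C b]; simp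
  set P : Fin s → F[X] := fun j => if S.card ≤ j then X ^ ((j : ℕ) - S.card) * g else X ^ (j : ℕ)
    with hP
  have hPm : ∀ j, (P j).Monic := by
    intro j; simp only [hP]; split_ifs
    · exact (monic_X_pow _).mul hgm
    · exact monic_X_pow _
  have hPd : ∀ j, (P j).natDegree = j := by
    intro j; simp only [hP]; split_ifs with h
    · rw [(monic_X_pow _).natDegree_mul hgm, natDegree_X_pow, hgd]; omega
    · exact natDegree_X_pow _
  have hdet := Matrix.det_matrixOfPolynomials P hPd hPm
  set Q : Matrix (Fin s) (Fin s) F := Matrix.of fun i j : Fin s => (P j).coeff i with hQ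
  have hcol : ∀ i j : Fin s, S.card ≤ j →
      (X - C m) ∣ ((Matrix.of fun i j : Fin s => A (i + j)) * Q.map C) i j := by
    intro i j hj
    rw [dvd_iff_isRoot, IsRoot, Matrix.mul_apply, eval_finsetSum]
    have hev : ∀ b, f m b * (P j).eval b = 0 := by
      intro b
      by_cases hb : f m b = 0
      · simp [hb]
      · have : g.eval b = 0 := by
          rw [hg, eval_prod]
          exact Finset.prod_eq_zero (i := b) (by simp [hS, hb]) (by simp)
        simp [hP, hj, this]
    calc ∑ l : Fin s, eval m (Matrix.of (fun i j : Fin s => A (i + j)) i l * Q.map C l j)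
        = ∑ l : Fin s, ∑ b, f m b * b ^ (i : ℕ) * ((P j).coeff l * b ^ (l : ℕ)) := by
          refine Finset.sum_congr rfl fun l _ => ?_
          simp only [Matrix.of_apply, Matrix.map_apply, eval_mul, eval_C, hA, hQ, Finset.sum_mul]
          exact Finset.sum_congr rfl fun b _ => by ring
      _ = ∑ b, b ^ (i : ℕ) * (f m b * (P j).eval b) := by
          rw [Finset.sum_comm]
          refine Finset.sum_congr rfl fun b _ => ?_
          rw [eval_eq_sum_range' (n := s) (by rw [hPd]; exact j.2), Finset.sum_range,
            Finset.mul_sum, Finset.mul_sum]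
          exact Finset.sum_congr rfl fun l _ => by ring
      _ = 0 := by simp [hev]
  have hdetQ : (Q.map C).det = 1 := by
    have := RingHom.map_det (C : F →+* F[X]) Q
    rw [hdet, map_one] at this
    exact this.symm
  choose B hB using hcol
  set v : Fin s → F[X] := fun j => if S.card ≤ (j : ℕ) then X - C m else 1 with hv
  set M : Matrix (Fin s) (Fin s) F[X] := Matrix.of fun i j : Fin s =>
    if h : S.card ≤ (j : ℕ) then B i j h
      else ((Matrix.of fun i j : Fin s => A (i + j)) * Q.map C) i j with hM
  have hfac : (Matrix.of fun i j : Fin s => A (i + j)) * Q.map C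
      = Matrix.of fun i j => v j * M i j := by
    ext1 i j
    by_cases h : S.card ≤ (j : ℕ)
    · simp only [Matrix.of_apply, hv, hM, h, if_true, dif_pos]
      exact hB i j h
    · simp only [Matrix.of_apply, hv, hM, h, if_false, one_mul, dif_neg, not_false_eq_true]
  have hprod : ∏ j, v j = (X - C m) ^ (s - S.card) := by
    have hIco : (Finset.range s).filter (fun j => S.card ≤ j) = Finset.Ico S.card s := by
      ext j; simp [and_comm]
    rw [Fin.prod_univ_eq_prod_range (fun j => if S.card ≤ j then X - C m else 1) s,
      Finset.prod_ite, Finset.prod_const, Finset.prod_const_one, mul_one, hIco, Nat.card_Ico]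
  have := congrArg Matrix.det hfac
  rw [Matrix.det_mul, hdetQ, mul_one, Matrix.det_mul_row, hprod] at this
  rw [this]
  exact dvd_mul_right _ _

theorem card_filter_mul_le_of_hasPolyMoments {f : F → F → F} (hf : HasPolyMoments f) (m₀ : F) :
    Fintype.card F * (Finset.univ.filter fun b => f m₀ b ≠ 0).card ≤
      (Finset.univ.filter fun b => f m₀ b ≠ 0).card *
        ((Finset.univ.filter fun b => f m₀ b ≠ 0).card - 1) +
      ∑ m, (Finset.univ.filter fun b => f m b ≠ 0).card := by
  choose A hAd hA using hf
  set S := Finset.univ.filter fun b => f m₀ b ≠ 0 with hS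
  set s := S.card with hs
  set Δ := (Matrix.of fun i j : Fin s => A (i + j)).det with hΔ
  have hne : Δ ≠ 0 := by
    intro h0
    have h1 : eval m₀ Δ = 0 := by rw [h0]; simp
    let e : Fin s ≃ S := S.equivFin.symm
    have h2 : (Matrix.of fun i j : Fin s => A (i + j)).map (eval m₀) =
        (Matrix.vandermonde fun i => (e i : F)).transpose *
          (Matrix.diagonal fun i => f m₀ (e i)) * Matrix.vandermonde fun i => (e i : F) := by
      ext i j
      rw [Matrix.mul_apply]
      simp only [Matrix.mul_diagonal, Matrix.transpose_apply, Matrix.vandermonde_apply,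
        Matrix.map_apply, Matrix.of_apply, hA]
      rw [← Finset.sum_subset (Finset.subset_univ S), ← Finset.sum_coe_sort S, ← Equiv.sum_comp e]
      · exact Finset.sum_congr rfl fun l _ => by rw [pow_add]; ring
      · intro b _ hb
        have : f m₀ b = 0 := by simpa [hS] using hb
        simp [this]
    have h3 : eval m₀ Δ = ((Matrix.of fun i j : Fin s => A (i + j)).map (eval m₀)).det := by
      have := RingHom.map_det (evalRingHom m₀) (Matrix.of fun i j : Fin s => A (i + j))
      simpa [RingHom.mapMatrix_apply] using this
    rw [h3, h2, Matrix.det_mul, Matrix.det_mul, Matrix.det_transpose, Matrix.det_diagonal] at h1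
    have hV : (Matrix.vandermonde fun i => (e i : F)).det ≠ 0 :=
      Matrix.det_vandermonde_ne_zero_iff.2 (Subtype.val_injective.comp e.injective)
    have hD : ∏ i, f m₀ (e i) ≠ 0 := Finset.prod_ne_zero_iff.2 fun i _ => by
      exact (Finset.mem_filter.1 (e i).2).2
    exact mul_ne_zero (mul_ne_zero hV hD) hV h1
  have hsum : ∑ m, (s - (Finset.univ.filter fun b => f m b ≠ 0).card) ≤ s * (s - 1) := by
    calc ∑ m, (s - (Finset.univ.filter fun b => f m b ≠ 0).card)
        ≤ ∑ m, Δ.roots.count m := Finset.sum_le_sum fun m _ => by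
          rw [count_roots, le_rootMultiplicity_iff hne]
          exact pow_dvd_hankel_det f A hA m
      _ = Multiset.card Δ.roots := Multiset.sum_count_eq_card fun a _ => Finset.mem_univ a
      _ ≤ Δ.natDegree := card_roots' _
      _ ≤ s * (s - 1) := natDegree_hankel_det_le A hAd
  calc Fintype.card F * s = ∑ m : F, s := by simp
    _ ≤ ∑ m, ((s - (Finset.univ.filter fun b => f m b ≠ 0).card)
          + (Finset.univ.filter fun b => f m b ≠ 0).card) :=
        Finset.sum_le_sum fun m _ => by omega
    _ ≤ _ := by rw [Finset.sum_add_distrib]; exact Nat.add_le_add_right hsum _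

end Moments

section Geometry

variable {F : Type} [Field F] {n : ℕ}

theorem finrank_sup_point {γ : Submodule F (Fin (n + 1) → F)} {P : PGPoint F n}
    (hP : ¬ P.1 ≤ γ) : finrank F ↥(γ ⊔ P.1) = finrank F γ + 1 := by
  have h := Submodule.finrank_sup_add_finrank_inf_eq γ P.1
  have hlt : γ ⊓ P.1 < P.1 := lt_of_le_of_ne inf_le_right fun h => hP (inf_eq_right.1 h)
  have := Submodule.finrank_lt_finrank_of_lt hlt
  have h1 := P.2
  omega

theorem exists_span_eq (P : PGPoint F n) : ∃ v, v ≠ 0 ∧ P.1 = F ∙ v := by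
  obtain ⟨v, hv, hv'⟩ := finrank_eq_one_iff'.1 P.2
  refine ⟨v, by simpa using hv, le_antisymm (fun w hw => ?_) ?_⟩
  · obtain ⟨a, ha⟩ := hv' ⟨w, hw⟩
    exact Submodule.mem_span_singleton.2 ⟨a, congrArg Subtype.val ha⟩
  · simp

variable [Fintype F]

noncomputable instance pgSubmoduleFintype : Fintype (Submodule F (Fin (n + 1) → F)) :=
  Fintype.ofFinite _

/-- The points of a subspace. -/
noncomputable def pgPts (κ : Submodule F (Fin (n + 1) → F)) : Finset (PGPoint F n) :=
  Finset.univ.filter fun P => P.1 ≤ κ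

@[simp] theorem mem_pgPts {κ : Submodule F (Fin (n + 1) → F)} {P : PGPoint F n} :
    P ∈ pgPts κ ↔ P.1 ≤ κ := by simp [pgPts]

theorem card_pgPts {κ : Submodule F (Fin (n + 1) → F)} {j : ℕ} (hκ : finrank F κ = j) :
    (pgPts κ).card = ∑ i ∈ Finset.range j, Fintype.card F ^ i := by
  have h := Projectivization.card_of_finrank F κ hκ
  rw [Nat.card_congr (Projectivization.equivSubmodule F κ), Nat.card_eq_fintype_card (α := F)] at h
  rw [← h, ← Nat.card_eq_finsetCard]
  symm
  have hmap : ∀ H : Submodule F κ, finrank F (H.map κ.subtype) = finrank F H := fun H =>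
    (LinearEquiv.finrank_eq (Submodule.equivMapOfInjective _ κ.subtype_injective H)).symm
  refine Nat.card_eq_of_bijective (fun H : {H : Submodule F κ // finrank F H = 1} =>
    (⟨⟨H.1.map κ.subtype, (hmap H.1).trans H.2⟩,
      mem_pgPts.2 (Submodule.map_subtype_le κ H.1)⟩ : ↥(pgPts κ))) ⟨fun H H' h => ?_, fun P => ?_⟩
  · exact Subtype.ext (Submodule.map_injective_of_injective κ.subtype_injective
      (congrArg (fun P => P.1.1) h))
  · have hP : (P.1.1.comap κ.subtype).map κ.subtype = P.1.1 := by
      rw [Submodule.map_comap_subtype]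
      exact inf_eq_right.2 (mem_pgPts.1 P.2)
    refine ⟨⟨P.1.1.comap κ.subtype, ?_⟩, Subtype.ext (Subtype.ext hP)⟩
    rw [← hmap, hP]
    exact P.1.2

/-- The subspaces of `κ` covering `γ`. -/
noncomputable def pgCovers (γ κ : Submodule F (Fin (n + 1) → F)) :
    Finset (Submodule F (Fin (n + 1) → F)) :=
  Finset.univ.filter fun δ => γ ≤ δ ∧ δ ≤ κ ∧ finrank F δ = finrank F γ + 1

theorem sum_pgCovers {γ κ : Submodule F (Fin (n + 1) → F)} (hγ : γ ≤ κ) (g : PGPoint F n → ℕ) :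
    ∑ δ ∈ pgCovers γ κ, ∑ P ∈ pgPts δ \ pgPts γ, g P = ∑ P ∈ pgPts κ \ pgPts γ, g P := by
  rw [← Finset.sum_fiberwise_of_maps_to (s := pgPts κ \ pgPts γ) (t := pgCovers γ κ)
    (g := fun P => γ ⊔ P.1)]
  · refine Finset.sum_congr rfl fun δ hδ => Finset.sum_congr ?_ fun _ _ => rfl
    obtain ⟨h1, h2, h3⟩ := (Finset.mem_filter.1 hδ).2
    ext P
    simp only [Finset.mem_sdiff, mem_pgPts, Finset.mem_filter]
    constructor
    · rintro ⟨hPδ, hPγ⟩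
      exact ⟨⟨hPδ.trans h2, hPγ⟩, Submodule.eq_of_le_of_finrank_eq (sup_le h1 hPδ)
        (by rw [finrank_sup_point hPγ, h3])⟩
    · rintro ⟨⟨_, hPγ⟩, rfl⟩
      exact ⟨le_sup_right, hPγ⟩
  · intro P hP
    simp only [Finset.mem_sdiff, mem_pgPts] at hP
    simp only [pgCovers, Finset.mem_filter, Finset.mem_univ, true_and]
    exact ⟨le_sup_left, sup_le hγ hP.1, finrank_sup_point hP.2⟩

theorem pgPts_subset {γ κ : Submodule F (Fin (n + 1) → F)} (h : γ ≤ κ) :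
    pgPts γ ⊆ pgPts κ := fun _ hP => mem_pgPts.2 ((mem_pgPts.1 hP).trans h)

theorem card_pgCovers {γ κ : Submodule F (Fin (n + 1) → F)} (hγ : γ ≤ κ) {i j : ℕ}
    (hi : finrank F γ = i) (hj : finrank F κ = i + j) :
    (pgCovers γ κ).card = ∑ l ∈ Finset.range j, Fintype.card F ^ l := by
  have h := sum_pgCovers hγ fun _ => 1
  simp only [Finset.sum_const, smul_eq_mul, mul_one] at h
  rw [Finset.sum_congr rfl (g := fun _ => Fintype.card F ^ i), Finset.sum_const, smul_eq_mul,
    Finset.card_sdiff_of_subset (pgPts_subset hγ), card_pgPts hi, card_pgPts hj,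
    Finset.sum_range_add, Nat.add_sub_cancel_left] at h
  · simp only [pow_add, ← Finset.mul_sum] at h
    rw [mul_comm] at h
    exact Nat.eq_of_mul_eq_mul_left (pow_pos Fintype.card_pos _) h
  · intro δ hδ
    obtain ⟨h1, h2, h3⟩ := (Finset.mem_filter.1 hδ).2
    rw [Finset.card_sdiff_of_subset (pgPts_subset h1), card_pgPts hi, card_pgPts h3, hi,
      Finset.sum_range_succ, Nat.add_sub_cancel_left]

/-- The value of `c` at the point spanned by `v`. -/
noncomputable def pgEval {p : ℕ} (c : PGPoint F n → ZMod p) (v : Fin (n + 1) → F) : ZMod p :=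
  if h : v ≠ 0 then c ⟨F ∙ v, finrank_span_singleton h⟩ else 0

theorem hasPolyMoments_of_mem_pgCode {p : ℕ} (ι : ZMod p →+* F) {c : PGPoint F n → ZMod p}
    (hc : c ∈ pgCode p F n) {e₁ e₂ r : Fin (n + 1) → F}
    (hne : ∀ m b : F, e₁ + m • e₂ + b • r ≠ 0) :
    HasPolyMoments fun m b => ι (pgEval c (e₁ + m • e₂ + b • r)) := by
  induction hc using Submodule.span_induction with
  | mem f hf =>
    obtain ⟨H, hH, rfl⟩ := hf
    have hlt : H < ⊤ := by
      refine lt_top_iff_ne_top.2 fun h => ?_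
      rw [h, finrank_top, finrank_fin_fun] at hH
      omega
    obtain ⟨φ, hφ, hle⟩ := Submodule.exists_le_ker_of_lt_top H hlt
    have hker : H = LinearMap.ker φ := by
      refine Submodule.eq_of_le_of_finrank_eq hle ?_
      have := Module.Dual.finrank_ker_add_one_of_ne_zero hφ
      rw [finrank_fin_fun] at this
      omega
    have hval : ∀ m b : F, ι (pgEval (pgInd p F n H) (e₁ + m • e₂ + b • r)) =
        if φ e₁ + m * φ e₂ + b * φ r = 0 then 1 else 0 := by
      intro m b
      have : (φ (e₁ + m • e₂ + b • r) = 0) = (φ e₁ + m * φ e₂ + b * φ r = 0) := by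
        simp [map_add]
      rw [pgEval, dif_pos (hne m b), pgInd]
      simp only [Submodule.span_singleton_le_iff_mem, hker, LinearMap.mem_ker, this]
      split_ifs <;> simp
    simp only [hval]
    by_cases hr : φ r = 0
    · simp only [hr, mul_zero, add_zero]
      exact hasPolyMoments_vertical _
    · convert hasPolyMoments_graph (-(φ e₂) / φ r) (-(φ e₁) / φ r) using 3 with m b
      refine if_congr ?_ rfl rfl
      field_simp
      constructor <;> intro h <;> linear_combination h
  | zero =>
    convert HasPolyMoments.zero (F := F) using 1
    ext m b
    simp [pgEval]
  | add x y _ _ hx hy =>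
    convert hx.add hy using 1
    ext m b
    simp [pgEval, hne m b]
  | smul a x _ hx =>
    convert hx.smul (ι a) using 1
    ext m b
    simp [pgEval, hne m b]

/-- If `s` points of a line `L` of a plane `π` do not have value `a`, then a codeword has at least
`s * (q - s)` nonzero values on `π` outside `L`. -/
theorem plane_line_bound {p : ℕ} [Fact p.Prime] (ι : ZMod p →+* F) {c : PGPoint F n → ZMod p}
    (hc : c ∈ pgCode p F n) {L π : Submodule F (Fin (n + 1) → F)} (hL : finrank F L = 2)
    (hπ : π ∈ pgCovers L ⊤) (a : ZMod p)
    (hs : ((pgPts L).filter fun P => c P ≠ a).card ≤ Fintype.card F) :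
    Fintype.card F * ((pgPts L).filter fun P => c P ≠ a).card ≤
      ((pgPts L).filter fun P => c P ≠ a).card * ((pgPts L).filter fun P => c P ≠ a).card +
        ((pgPts π \ pgPts L).filter fun P => c P ≠ 0).card := by
  have hLcard : (pgPts L).card = Fintype.card F + 1 := by
    rw [card_pgPts hL]; simp [Finset.sum_range_succ, add_comm]
  obtain ⟨hLπ, -, hπ3⟩ := (Finset.mem_filter.1 hπ).2
  obtain ⟨R, hRL, hRa⟩ : ∃ R ∈ pgPts L, c R = a := by
    by_contra! h
    rw [Finset.filter_true_of_mem h] at hs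
    omega
  obtain ⟨r, hr, hRr⟩ := exists_span_eq R
  have hrL : r ∈ L := by
    rw [mem_pgPts, hRr, Submodule.span_singleton_le_iff_mem] at hRL
    exact hRL
  obtain ⟨e₁, he₁L, he₁⟩ : ∃ e ∈ L, e ∉ R.1 := by
    by_contra! h
    have := Submodule.finrank_mono (R := F) (s := L) (t := R.1) h
    rw [R.2] at this
    omega
  obtain ⟨e₂, he₂π, he₂⟩ : ∃ e ∈ π, e ∉ L := by
    by_contra! h
    have := Submodule.finrank_mono (R := F) (s := π) (t := L) h
    omega
  have hlin : ∀ x y : F, x • e₁ + y • r = 0 → x = 0 ∧ y = 0 := by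
    intro x y h
    have hx : x = 0 := by
      by_contra hx
      apply he₁
      have : e₁ = (-(x⁻¹ * y)) • r := by
        rw [neg_smul, eq_neg_iff_add_eq_zero, mul_smul]
        have := congrArg (x⁻¹ • ·) h
        simpa [smul_add, smul_smul, hx] using this
      rw [this, hRr]
      exact Submodule.smul_mem _ _ (Submodule.mem_span_singleton_self r)
    refine ⟨hx, ?_⟩
    simpa [hx, hr] using h
  have hlin3 : ∀ x z y : F, x • e₁ + z • e₂ + y • r = 0 → x = 0 ∧ z = 0 ∧ y = 0 := by
    intro x z y h
    have hz : z = 0 := by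
      by_contra hz
      apply he₂
      have : e₂ = -(z⁻¹ • (x • e₁ + y • r)) := by
        rw [eq_neg_iff_add_eq_zero]
        have := congrArg (z⁻¹ • ·) h
        simp only [smul_add, smul_smul, hz, ne_eq, not_false_eq_true, inv_mul_cancel₀, one_smul,
          smul_zero] at this ⊢
        rw [← this]; abel
      rw [this]
      exact L.neg_mem (L.smul_mem _ (L.add_mem (L.smul_mem _ he₁L) (L.smul_mem _ hrL)))
    obtain ⟨hx, hy⟩ := hlin x y (by simpa [hz] using h)
    exact ⟨hx, hz, hy⟩
  have hne : ∀ m b : F, e₁ + m • e₂ + b • r ≠ 0 := by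
    intro m b h
    exact one_ne_zero (hlin3 1 m b (by simpa using h)).1
  let Φ : F → F → PGPoint F n := fun m b => ⟨F ∙ (e₁ + m • e₂ + b • r),
    finrank_span_singleton (hne m b)⟩
  have hΦinj : ∀ m b m' b', Φ m b = Φ m' b' → m = m' ∧ b = b' := by
    intro m b m' b' h
    have h1 : e₁ + m • e₂ + b • r ∈ F ∙ (e₁ + m' • e₂ + b' • r) := by
      have h0 : F ∙ (e₁ + m • e₂ + b • r) = F ∙ (e₁ + m' • e₂ + b' • r) := congrArg Subtype.val h
      rw [← h0]
      exact Submodule.mem_span_singleton_self _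
    obtain ⟨t, ht⟩ := Submodule.mem_span_singleton.1 h1
    obtain ⟨h2, h3, h4⟩ := hlin3 (t - 1) (t * m' - m) (t * b' - b) (by
      rw [← sub_eq_zero] at ht
      rw [← ht]
      module)
    have ht1 : t = 1 := by linear_combination h2
    subst ht1
    exact ⟨by linear_combination -h3, by linear_combination -h4⟩
  have hΦL : ∀ b, (Φ 0 b).1 ≤ L := by
    intro b
    simp only [Φ, Submodule.span_singleton_le_iff_mem]
    simpa using L.add_mem he₁L (L.smul_mem _ hrL)
  have hΦR : ∀ m b, ¬ (Φ m b).1 ≤ R.1 := by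
    intro m b h
    simp only [Φ, Submodule.span_singleton_le_iff_mem, hRr] at h
    obtain ⟨t, ht⟩ := Submodule.mem_span_singleton.1 h
    exact one_ne_zero (hlin3 1 m (b - t) (by rw [sub_smul, ht]; module)).1
  have hΦsurj : ∀ P : PGPoint F n, P.1 ≤ L → P ≠ R → ∃ b, Φ 0 b = P := by
    intro P hPL hPR
    obtain ⟨v, hv, hPv⟩ := exists_span_eq P
    have hspan : R.1 ⊔ F ∙ e₁ = L := by
      have hle : R.1 ⊔ F ∙ e₁ ≤ L :=
        sup_le (mem_pgPts.1 hRL) ((Submodule.span_singleton_le_iff_mem _ _).2 he₁L)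
      refine Submodule.eq_of_le_of_finrank_le hle ?_
      have hlt : R.1 < R.1 ⊔ F ∙ e₁ := lt_of_le_of_ne le_sup_left fun h => he₁ (by
        rw [h]
        exact Submodule.mem_sup_right (Submodule.mem_span_singleton_self e₁))
      have := Submodule.finrank_lt_finrank_of_lt hlt
      rw [R.2] at this
      omega
    have hvL : v ∈ R.1 ⊔ F ∙ e₁ := by
      rw [hspan]
      rwa [hPv, Submodule.span_singleton_le_iff_mem] at hPL
    obtain ⟨y, hy, z, hz, rfl⟩ := Submodule.mem_sup.1 hvL
    rw [hRr] at hy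
    obtain ⟨b, rfl⟩ := Submodule.mem_span_singleton.1 hy
    obtain ⟨x, rfl⟩ := Submodule.mem_span_singleton.1 hz
    have hx : x ≠ 0 := by
      rintro rfl
      apply hPR
      apply Subtype.ext
      refine Submodule.eq_of_le_of_finrank_eq ?_ (by rw [P.2, R.2])
      rw [hPv, hRr, Submodule.span_singleton_le_iff_mem]
      simpa using hy
    refine ⟨x⁻¹ * b, Subtype.ext ?_⟩
    have : e₁ + (0 : F) • e₂ + (x⁻¹ * b) • r = x⁻¹ • (b • r + x • e₁) := by
      simp [smul_add, smul_smul, hx, add_comm]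
    simp only [Φ, hPv, this]
    exact Submodule.span_singleton_smul_eq (IsUnit.mk0 _ (inv_ne_zero hx)) _
  have hf : HasPolyMoments fun m b => ι (c (Φ m b)) - if m = 0 then ι a else 0 := by
    have h1 := hasPolyMoments_of_mem_pgCode ι hc hne
    have h2 := (hasPolyMoments_vertical fun m : F => if m = 0 then ι a else 0).smul (-1)
    convert h1.add h2 using 1
    ext m b
    simp [pgEval, hne m b, Φ, sub_eq_add_neg]
  have key := card_filter_mul_le_of_hasPolyMoments hf 0
  have hs0 : (Finset.univ.filter fun b => ι (c (Φ 0 b)) - (if (0 : F) = 0 then ι a else 0) ≠ 0).card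
      = ((pgPts L).filter fun P => c P ≠ a).card := by
    refine Finset.card_bij (fun b _ => Φ 0 b) ?_ ?_ ?_
    · intro b hb
      simp only [if_true, Finset.mem_filter, Finset.mem_univ, true_and, ne_eq, sub_eq_zero,
        ι.injective.eq_iff] at hb
      simp [hb, hΦL]
    · intro b _ b' _ h
      exact (hΦinj _ _ _ _ h).2
    · intro P hP
      simp only [Finset.mem_filter, mem_pgPts] at hP
      obtain ⟨b, rfl⟩ := hΦsurj P hP.1 fun h => hP.2 (h ▸ hRa)
      refine ⟨b, ?_, rfl⟩
      simpa [sub_eq_zero, ι.injective.eq_iff] using hP.2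
  have hsm : ∑ m ∈ Finset.univ.erase (0 : F),
      (Finset.univ.filter fun b => ι (c (Φ m b)) - (if m = 0 then ι a else 0) ≠ 0).card ≤
      ((pgPts π \ pgPts L).filter fun P => c P ≠ 0).card := by
    rw [← Finset.card_sigma]
    refine Finset.card_le_card_of_injOn (fun x => Φ x.1 x.2) ?_ ?_
    · rintro ⟨m, b⟩ hmb
      simp only [Finset.coe_sigma, Set.mem_sigma_iff, Finset.mem_coe, Finset.mem_erase,
        Finset.mem_univ, and_true, Finset.mem_filter, true_and] at hmb
      obtain ⟨hm, hb⟩ := hmb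
      simp only [hm, if_false, sub_zero] at hb
      simp only [Finset.coe_filter, Finset.mem_sdiff, mem_pgPts, Set.mem_ofPred_eq]
      refine ⟨⟨?_, fun h => ?_⟩, fun h => hb (by simp [h])⟩
      · simp only [Φ, Submodule.span_singleton_le_iff_mem]
        exact π.add_mem (π.add_mem (hLπ he₁L) (π.smul_mem _ he₂π)) (π.smul_mem _ (hLπ hrL))
      · simp only [Φ, Submodule.span_singleton_le_iff_mem] at h
        apply he₂
        have h1 : m • e₂ ∈ L := by
          have := L.sub_mem (L.sub_mem h he₁L) (L.smul_mem b hrL)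
          convert this using 1
          abel
        exact (L.smul_mem_iff hm).1 h1
    · rintro ⟨m, b⟩ _ ⟨m', b'⟩ _ h
      obtain ⟨rfl, rfl⟩ := hΦinj _ _ _ _ h
      rfl
  rw [← Finset.add_sum_erase _ _ (Finset.mem_univ (0 : F)), hs0] at key
  generalize ((pgPts L).filter fun P => c P ≠ a).card = s at *
  rcases s with _ | s
  · simp
  · simp only [Nat.add_sub_cancel] at key
    nlinarith

end Geometry

theorem mul_sub_le_of_thick {q e x : ℝ} (he : 1 ≤ e) (hex : e ≤ x) (hx : q + 1 - e ≤ x)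
    (hxq : x ≤ q + 1) : x * (q + 1 - x) ≤ e * (q + 1 - x) + q * e := by
  have h1 : (x - e) * (q + 1 - x) ≤ q * e :=
    mul_le_mul (by linarith) (by linarith) (by linarith) (by linarith)
  linarith

theorem le_add_of_thick_count {q r d e T : ℝ} (hq : 32 ≤ q) (he : 1 ≤ e) (he12 : 12 * e ≤ q)
    (heq : 4 * (e + 1) ^ 2 ≤ q) (hr : 0 ≤ r) (hd : d ≤ 2 * e * r)
    (hT : T * (9 * q ^ 2) ≤ 16 * r * d)
    (hmain : d * (q * r + 1 - d) ≤ e * r * (q * r + 1 - d) + q * e * T) :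
    5 * q * d ≤ 5 * q * (e * r) + 6 * r := by
  rcases le_or_gt d (e * r) with hle | hgt
  · have := mul_le_mul_of_nonneg_left hle (by linarith : 0 ≤ 5 * q)
    linarith
  have hrpos : 0 < r := by
    refine hr.lt_of_ne fun h0 => ?_
    simp only [← h0, mul_zero] at hd hgt
    linarith
  have h1 : (d - e * r) * (5 / 6 * q * r) ≤ q * e * T := by
    have h2 : 12 * e * r ≤ q * r := mul_le_mul_of_nonneg_right he12 hr
    have h3 : 5 / 6 * q * r ≤ q * r + 1 - d := by linarith
    have h4 := mul_le_mul_of_nonneg_left h3 (sub_nonneg.2 hgt.le)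
    linarith
  have h2 : (d - e * r) * (5 / 6 * q * r) * (9 * q) ≤ e * (16 * r * d) := by
    have h3 := mul_le_mul_of_nonneg_left hT (by linarith : 0 ≤ e)
    have h4 := mul_le_mul_of_nonneg_right h1 (by linarith : 0 ≤ 9 * q)
    linarith
  have h3 : (d - e * r) * (15 / 2) * q ^ 2 ≤ 16 * e * d := by
    have : (d - e * r) * (15 / 2) * q ^ 2 * r ≤ 16 * e * d * r := by linarith
    exact le_of_mul_le_mul_right this hrpos
  have h4 : 16 * e * d ≤ 8 * q * r := by
    have h5 := mul_le_mul_of_nonneg_left hd (by linarith : 0 ≤ 16 * e)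
    have h6 : 4 * e ^ 2 ≤ q := by linarith [heq, sq_nonneg (e + 1)]
    have h7 := mul_le_mul_of_nonneg_right h6 (by linarith : 0 ≤ 8 * r)
    linarith
  have h5 : (d - e * r) * (15 / 2) * q ≤ 8 * r := by
    have : (d - e * r) * (15 / 2) * q * q ≤ 8 * r * q := by linarith
    exact le_of_mul_le_mul_right this (by linarith)
  linarith

/-- A finite linear space in which all lines `pts L`, for `L ∈ Ls`, have `q + 1` points and every
point of `X` is on `r` lines. -/
structure IsUniformLinearSpace {α β : Type*} (X : Finset α) (Ls : Finset β)
    (pts : β → Finset α) (q r : ℕ) : Prop where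
  subset : ∀ L ∈ Ls, pts L ⊆ X
  card_line : ∀ L ∈ Ls, (pts L).card = q + 1
  card_lines : ∀ P ∈ X, (Ls.filter fun L => P ∈ pts L).card = r
  card_join : ∀ P ∈ X, ∀ Q ∈ X, P ≠ Q → (Ls.filter fun L => P ∈ pts L ∧ Q ∈ pts L).card = 1
  card_points : X.card = q * r + 1

namespace IsUniformLinearSpace

variable {α β : Type*} {X : Finset α} {Ls : Finset β} {pts : β → Finset α} {q r : ℕ}

theorem sum_lines (h : IsUniformLinearSpace X Ls pts q r) (g : α → ℕ) :
    ∑ L ∈ Ls, ∑ P ∈ pts L, g P = r * ∑ P ∈ X, g P := by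
  rw [Finset.sum_comm' (s' := fun P => Ls.filter fun L => P ∈ pts L) (t' := X), Finset.mul_sum]
  · exact Finset.sum_congr rfl fun P hP => by
      rw [Finset.sum_const, h.card_lines P hP, smul_eq_mul]
  · intro L P
    simp only [Finset.mem_filter]
    exact ⟨fun ⟨hL, hP⟩ => ⟨⟨hL, hP⟩, h.subset L hL hP⟩, fun ⟨⟨hL, hP⟩, _⟩ => ⟨hL, hP⟩⟩

theorem sum_pairs (h : IsUniformLinearSpace X Ls pts q r) (g : α → α → ℕ)
    (hg : ∀ P, g P P = 0) :
    ∑ L ∈ Ls, ∑ P ∈ pts L, ∑ Q ∈ pts L, g P Q = ∑ P ∈ X, ∑ Q ∈ X, g P Q := by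
  rw [Finset.sum_comm' (s' := fun P => Ls.filter fun L => P ∈ pts L) (t' := X)]
  · refine Finset.sum_congr rfl fun P hP => ?_
    rw [Finset.sum_comm' (s' := fun Q => Ls.filter fun L => P ∈ pts L ∧ Q ∈ pts L) (t' := X)]
    · refine Finset.sum_congr rfl fun Q hQ => ?_
      by_cases hPQ : P = Q
      · simp [hPQ, hg]
      · rw [Finset.sum_const, h.card_join P hP Q hQ hPQ, one_smul]
    · intro L Q
      simp only [Finset.mem_filter]
      exact ⟨fun ⟨⟨hL, hP⟩, hQ⟩ => ⟨⟨hL, hP, hQ⟩, h.subset L hL hQ⟩,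
        fun ⟨⟨hL, hP, hQ⟩, _⟩ => ⟨⟨hL, hP⟩, hQ⟩⟩
  · intro L P
    simp only [Finset.mem_filter]
    exact ⟨fun ⟨hL, hP⟩ => ⟨⟨hL, hP⟩, h.subset L hL hP⟩, fun ⟨⟨hL, hP⟩, _⟩ => ⟨hL, hP⟩⟩

theorem card_mul (h : IsUniformLinearSpace X Ls pts q r) :
    Ls.card * (q + 1) = r * (q * r + 1) := by
  have := h.sum_lines fun _ => 1
  simp only [Finset.sum_const, smul_eq_mul, mul_one, h.card_points] at this
  rw [← this, Finset.sum_congr rfl h.card_line, Finset.sum_const, smul_eq_mul]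

/-- If every line is almost monochromatic, then one colour dominates. -/
theorem exists_dominant (h : IsUniformLinearSpace X Ls pts q r) {γ : Type*} [DecidableEq γ]
    (c : α → γ) {e : ℕ}
    (he : ∀ L ∈ Ls, ∃ a, ((pts L).filter fun P => c P ≠ a).card ≤ e) :
    ∃ a, (X.filter fun P => c P ≠ a).card ≤ 2 * e * r := by
  have hpair := h.sum_pairs (fun P Q => if c Q ≠ c P then 1 else 0) (by simp)
  have hline : ∀ L ∈ Ls, ∑ P ∈ pts L, ∑ Q ∈ pts L, (if c Q ≠ c P then 1 else 0)
      ≤ 2 * e * (q + 1) := by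
    intro L hL
    obtain ⟨a, ha⟩ := he L hL
    calc ∑ P ∈ pts L, ∑ Q ∈ pts L, (if c Q ≠ c P then 1 else 0)
        ≤ ∑ P ∈ pts L, ∑ Q ∈ pts L, ((if c P ≠ a then 1 else 0) + if c Q ≠ a then 1 else 0) := by
          refine Finset.sum_le_sum fun P _ => Finset.sum_le_sum fun Q _ => ?_
          by_cases hP : c P = a
          · simp [hP]
          · split_ifs <;> simp_all
      _ = 2 * ((pts L).filter fun P => c P ≠ a).card * (q + 1) := by
          simp only [Finset.sum_add_distrib, Finset.sum_const, smul_eq_mul, ← Finset.card_filter,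
            h.card_line L hL, ← Finset.mul_sum]
          ring
      _ ≤ 2 * e * (q + 1) := by gcongr
  have htot : ∑ P ∈ X, (X.filter fun Q => c Q ≠ c P).card ≤ X.card * (2 * e * r) := by
    simp only [Finset.card_filter]
    rw [← hpair]
    calc _ ≤ ∑ L ∈ Ls, 2 * e * (q + 1) := Finset.sum_le_sum hline
      _ = 2 * e * (Ls.card * (q + 1)) := by rw [Finset.sum_const, smul_eq_mul]; ring
      _ = X.card * (2 * e * r) := by rw [h.card_mul, h.card_points]; ring
  have hne : X.Nonempty := Finset.card_pos.1 (by rw [h.card_points]; omega)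
  rw [← smul_eq_mul, ← Finset.sum_const] at htot
  obtain ⟨P, -, hP⟩ := Finset.exists_le_of_sum_le hne htot
  exact ⟨c P, hP⟩

theorem sum_card_inter (h : IsUniformLinearSpace X Ls pts q r) {D : Finset α} (hD : D ⊆ X) :
    ∑ L ∈ Ls, (pts L ∩ D).card = r * D.card := by
  have := h.sum_lines fun P => if P ∈ D then 1 else 0
  simpa only [← Finset.card_filter, Finset.filter_mem_eq_inter, Finset.inter_eq_right.2 hD]
    using this

theorem sum_card_inter_sq (h : IsUniformLinearSpace X Ls pts q r) {D : Finset α} (hD : D ⊆ X) :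
    ∑ L ∈ Ls, ((pts L ∩ D).card : ℝ) ^ 2 = D.card * (D.card + r - 1) := by
  have h1 := h.sum_pairs (fun P Q => if P ∈ D ∧ Q ∈ D ∧ P ≠ Q then 1 else 0) (by simp)
  have h2 : ∀ Y : Finset α, ∑ P ∈ Y, ∑ Q ∈ Y, (if P ∈ D ∧ Q ∈ D ∧ P ≠ Q then 1 else 0)
      + (Y ∩ D).card = (Y ∩ D).card ^ 2 := by
    intro Y
    have : ∀ P ∈ Y, ∑ Q ∈ Y, (if P ∈ D ∧ Q ∈ D ∧ P ≠ Q then 1 else 0)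
        + (if P ∈ D then 1 else 0) = if P ∈ D then (Y ∩ D).card else 0 := by
      intro P hP
      by_cases hPD : P ∈ D
      · simp only [hPD, true_and, if_true, ← Finset.card_filter]
        rw [← Finset.card_erase_add_one (Finset.mem_inter.2 ⟨hP, hPD⟩)]
        congr 2
        ext Q
        simp only [Finset.mem_filter, Finset.mem_erase, Finset.mem_inter]
        tauto
      · simp [hPD]
    rw [← Finset.filter_mem_eq_inter, Finset.card_filter, ← Finset.sum_add_distrib,
      Finset.sum_congr rfl this, ← Finset.sum_filter, Finset.sum_const, Finset.filter_mem_eq_inter,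
      ← Finset.card_filter, Finset.filter_mem_eq_inter, smul_eq_mul, sq]
  have h3 := h2 X
  rw [Finset.inter_eq_right.2 hD, ← h1] at h3
  have h4 := h.sum_card_inter hD
  have h5 : ∑ L ∈ Ls, (pts L ∩ D).card ^ 2 + D.card = D.card ^ 2 + r * D.card := by
    rw [← Finset.sum_congr rfl fun L _ => h2 (pts L), Finset.sum_add_distrib, h4, ← h3]
    ring
  have h6 : (∑ L ∈ Ls, ((pts L ∩ D).card : ℝ) ^ 2) + D.card = D.card ^ 2 + r * D.card := by
    exact_mod_cast h5
  linear_combination h6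

/-- A set that every line meets in at most `e` or at least `q + 1 - e` points, and that is not too
large, has at most about `e * r` points. -/
theorem card_le_of_thin_or_thick (h : IsUniformLinearSpace X Ls pts q r) {D : Finset α}
    (hD : D ⊆ X) {e : ℕ} (heq : 4 * (e + 1) ^ 2 ≤ q) (hq : 32 ≤ q)
    (hL : ∀ L ∈ Ls, (pts L ∩ D).card ≤ e ∨ q + 1 ≤ (pts L ∩ D).card + e)
    (hd : D.card ≤ 2 * e * r) : 5 * q * D.card ≤ 5 * q * (e * r) + 6 * r := by
  rcases Nat.eq_zero_or_pos e with rfl | he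
  · have : D.card = 0 := by simpa using hd
    simp [this]
  have he12 : 12 * e ≤ q := by
    rcases Nat.lt_or_ge e 3 with h3 | h3
    · interval_cases e <;> omega
    · nlinarith
  set T := Ls.filter fun L => e < (pts L ∩ D).card with hT
  have hx : ∀ L ∈ Ls, ((pts L ∩ D).card : ℝ) ≤ q + 1 := by
    intro L hL
    have := Finset.card_le_card (Finset.inter_subset_left (s₁ := pts L) (s₂ := D))
    rw [h.card_line L hL] at this
    exact_mod_cast this
  have hthick : ∀ L ∈ T, (q : ℝ) + 1 - e ≤ (pts L ∩ D).card := by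
    intro L hLT
    obtain ⟨h1, h2⟩ := Finset.mem_filter.1 hLT
    have : q + 1 ≤ (pts L ∩ D).card + e := (hL L h1).resolve_left (by omega)
    rw [sub_le_iff_le_add]
    exact_mod_cast this
  have hS1 : ∑ L ∈ Ls, ((pts L ∩ D).card : ℝ) = r * D.card := by
    exact_mod_cast h.sum_card_inter hD
  have hS2 := h.sum_card_inter_sq hD
  have hB : (Ls.card : ℝ) * (q + 1) = r * (q * r + 1) := by exact_mod_cast h.card_mul
  have hdN : (D.card : ℝ) ≤ q * r + 1 := by
    have := Finset.card_le_card hD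
    rw [h.card_points] at this
    exact_mod_cast this
  have hd' : (D.card : ℝ) ≤ 2 * e * r := by exact_mod_cast hd
  have he12' : 12 * (e : ℝ) ≤ q := by exact_mod_cast he12
  have heq' : 4 * ((e : ℝ) + 1) ^ 2 ≤ q := by exact_mod_cast heq
  have hq' : (32 : ℝ) ≤ q := by exact_mod_cast hq
  have he' : (1 : ℝ) ≤ e := by exact_mod_cast he
  have hr0 : (0 : ℝ) ≤ r := Nat.cast_nonneg r
  have hd0 : (0 : ℝ) ≤ D.card := Nat.cast_nonneg _
  set d : ℝ := (D.card : ℝ) with hdd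
  set N : ℝ := q * r + 1 with hN
  have hNpos : 0 < N := by positivity
  set t : ℝ := d * (q + 1) / N with ht
  have htN : t * N = d * (q + 1) := by rw [ht]; field_simp
  have ht_le : t ≤ 2 * e + 1 := by
    rw [ht, div_le_iff₀ hNpos, hN]
    nlinarith [mul_le_mul_of_nonneg_right hd' (by positivity : (0 : ℝ) ≤ q + 1),
      mul_nonneg hr0 (by linarith : (0 : ℝ) ≤ q - 2 * e)]
  have hvar : ∑ L ∈ Ls, (((pts L ∩ D).card : ℝ) - t) ^ 2 ≤ r * d := by
    have hBt : (Ls.card : ℝ) * t ^ 2 = r * d * t := by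
      have h1 : Ls.card * t = r * d := by
        refine mul_right_cancel₀ hNpos.ne' ?_
        linear_combination Ls.card * htN + d * hB
      linear_combination t * h1
    have : ∑ L ∈ Ls, (((pts L ∩ D).card : ℝ) - t) ^ 2 = d * (d + r - 1) - r * d * t := by
      calc _ = ∑ L ∈ Ls, (((pts L ∩ D).card : ℝ) ^ 2 - 2 * t * (pts L ∩ D).card + t ^ 2) :=
            Finset.sum_congr rfl fun L _ => by ring
        _ = _ := by
            rw [Finset.sum_add_distrib, Finset.sum_sub_distrib, ← Finset.mul_sum, hS1, hS2,
              Finset.sum_const, nsmul_eq_mul, hBt]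
            ring
    rw [this]
    have h2 : d - 1 ≤ r * t := by
      have : (d - 1) * N ≤ r * t * N := by
        rw [mul_assoc, htN, hN]
        nlinarith
      exact le_of_mul_le_mul_right this hNpos
    nlinarith
  have hb : (T.card : ℝ) * (9 * q ^ 2) ≤ 16 * r * d := by
    have h1 : ∑ L ∈ T, (3 / 4 * (q : ℝ)) ^ 2 ≤ ∑ L ∈ T, (((pts L ∩ D).card : ℝ) - t) ^ 2 := by
      refine Finset.sum_le_sum fun L hLT => ?_
      have := hthick L hLT
      gcongr
      linarith
    have h2 : ∑ L ∈ T, (((pts L ∩ D).card : ℝ) - t) ^ 2 ≤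
        ∑ L ∈ Ls, (((pts L ∩ D).card : ℝ) - t) ^ 2 :=
      Finset.sum_le_sum_of_subset_of_nonneg (Finset.filter_subset _ _) fun _ _ _ => sq_nonneg _
    rw [Finset.sum_const, nsmul_eq_mul] at h1
    linarith
  have hmain : d * (N - d) ≤ e * r * (N - d) + q * e * T.card := by
    have h1 : ∑ L ∈ Ls, ((pts L ∩ D).card : ℝ) * (q + 1 - (pts L ∩ D).card) ≤
        ∑ L ∈ Ls, (e * ((q : ℝ) + 1 - (pts L ∩ D).card) +
          if e < (pts L ∩ D).card then (q : ℝ) * e else 0) := by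
      refine Finset.sum_le_sum fun L hLL => ?_
      have hxL := hx L hLL
      split_ifs with hlt
      · have h2 := hthick L (Finset.mem_filter.2 ⟨hLL, hlt⟩)
        have h3 : (e : ℝ) ≤ (pts L ∩ D).card := by exact_mod_cast hlt.le
        exact mul_sub_le_of_thick he' h3 h2 hxL
      · have h3 : ((pts L ∩ D).card : ℝ) ≤ e := by exact_mod_cast not_lt.1 hlt
        linarith [mul_le_mul_of_nonneg_right h3
          (by linarith : (0 : ℝ) ≤ q + 1 - (pts L ∩ D).card)]
    have h2 : ∑ L ∈ Ls, ((pts L ∩ D).card : ℝ) * (q + 1 - (pts L ∩ D).card) =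
        (q + 1) * (r * d) - d * (d + r - 1) := by
      rw [← hS1, ← hS2, Finset.mul_sum, ← Finset.sum_sub_distrib]
      exact Finset.sum_congr rfl fun L _ => by ring
    rw [h2, Finset.sum_add_distrib, ← Finset.mul_sum, Finset.sum_sub_distrib, hS1,
      Finset.sum_const, nsmul_eq_mul, hB, ← Finset.sum_filter, Finset.sum_const, nsmul_eq_mul] at h1
    linear_combination h1
  have hfin := le_add_of_thick_count hq' he' he12' heq' hr0 hd' hb hmain
  rw [hdd] at hfin
  exact_mod_cast hfin

theorem card_inter_le_one (h : IsUniformLinearSpace X Ls pts q r) {L L' : β} (hL : L ∈ Ls)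
    (hL' : L' ∈ Ls) (hne : L ≠ L') : (pts L ∩ pts L').card ≤ 1 := by
  by_contra! hlt
  obtain ⟨P, hP, Q, hQ, hPQ⟩ := Finset.one_lt_card.1 hlt
  rw [Finset.mem_inter] at hP hQ
  have h1 := h.card_join P (h.subset L hL hP.1) Q (h.subset L hL hQ.1) hPQ
  have h2 := Finset.card_le_one.1 h1.le L (by simp [*]) L' (by simp [*])
  exact hne h2

theorem mul_le_card_biUnion (h : IsUniformLinearSpace X Ls pts q r) {D : Finset α} {y : ℕ}
    (S : Finset β) (hS : S ⊆ Ls) (hy : ∀ L ∈ S, y ≤ (pts L ∩ D).card) :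
    S.card * y ≤ (S.biUnion fun L => pts L ∩ D).card + S.card ^ 2 := by
  induction S using Finset.induction_on with
  | empty => simp
  | insert L S hLS ih =>
    have ih := ih (fun _ hx => hS (Finset.mem_insert_of_mem hx))
      fun L' hL' => hy L' (Finset.mem_insert_of_mem hL')
    have h1 := Finset.card_union_add_card_inter (pts L ∩ D) (S.biUnion fun L => pts L ∩ D)
    have h2 : ((pts L ∩ D) ∩ S.biUnion fun L => pts L ∩ D).card ≤ S.card := by
      rw [Finset.inter_biUnion]
      refine (Finset.card_biUnion_le_card_mul _ _ 1 fun L' hL' => ?_).trans (by simp)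
      refine (Finset.card_le_card ?_).trans (h.card_inter_le_one (hS (Finset.mem_insert_self L S))
        (hS (Finset.mem_insert_of_mem hL')) fun h => hLS (h ▸ hL'))
      exact Finset.inter_subset_inter Finset.inter_subset_left Finset.inter_subset_left
    have h3 := hy L (Finset.mem_insert_self L S)
    rw [Finset.biUnion_insert, Finset.card_insert_of_notMem hLS]
    nlinarith

theorem card_biUnion_le (h : IsUniformLinearSpace X Ls pts q r)
    (hmeet : ∀ L ∈ Ls, ∀ L' ∈ Ls, (pts L ∩ pts L').Nonempty) (S : Finset β) (hS : S ⊆ Ls) :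
    (S.biUnion pts).card ≤ S.card * q + 1 := by
  induction S using Finset.induction_on with
  | empty => simp
  | insert L S hLS ih =>
    have ih := ih fun _ hx => hS (Finset.mem_insert_of_mem hx)
    have h1 := Finset.card_union_add_card_inter (pts L) (S.biUnion pts)
    have h3 := h.card_line L (hS (Finset.mem_insert_self L S))
    rw [Finset.biUnion_insert, Finset.card_insert_of_notMem hLS, add_mul, one_mul]
    rcases S.eq_empty_or_nonempty with rfl | ⟨L', hL'⟩
    · simp [h3]
    · obtain ⟨P, hP⟩ := hmeet L (hS (Finset.mem_insert_self L S)) L'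
        (hS (Finset.mem_insert_of_mem hL'))
      rw [Finset.mem_inter] at hP
      have : 0 < (pts L ∩ S.biUnion pts).card := Finset.card_pos.2
        ⟨P, Finset.mem_inter.2 ⟨hP.1, Finset.mem_biUnion.2 ⟨L', hL', hP.2⟩⟩⟩
      omega

/-- In a projective plane, a set that every line meets in at most `e` or at least `q + 1 - e`
points, and that is not too large, has at most `e * q + 1` points. -/
theorem card_le_of_plane (h : IsUniformLinearSpace X Ls pts q (q + 1))
    (hmeet : ∀ L ∈ Ls, ∀ L' ∈ Ls, (pts L ∩ pts L').Nonempty) {D : Finset α}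
    (hD : D ⊆ X) {e : ℕ} (heq : 4 * (e + 1) ^ 2 ≤ q) (hq : 32 ≤ q)
    (hL : ∀ L ∈ Ls, (pts L ∩ D).card ≤ e ∨ q + 1 ≤ (pts L ∩ D).card + e)
    (hd : D.card ≤ 2 * e * (q + 1)) : D.card ≤ e * q + 1 := by
  have h1 := h.card_le_of_thin_or_thick hD heq hq hL hd
  have hd1 : D.card ≤ e * (q + 1) + 1 := by
    by_contra! hlt
    have := Nat.mul_le_mul_left (5 * q) (Nat.succ_le_of_lt hlt)
    nlinarith
  set T := Ls.filter fun L => e < (pts L ∩ D).card with hT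
  by_cases hex : ∃ P ∈ D, ∀ L ∈ T, P ∉ pts L
  · obtain ⟨P, hPD, hP⟩ := hex
    have h2 : (D.erase P).card ≤ ∑ L ∈ Ls.filter (fun L => P ∈ pts L),
        ((pts L ∩ D).erase P).card := by
      refine (Finset.card_le_card ?_).trans Finset.card_biUnion_le
      intro Q hQ
      obtain ⟨hQP, hQD⟩ := Finset.mem_erase.1 hQ
      have h3 := h.card_join P (hD hPD) Q (hD hQD) (Ne.symm hQP)
      obtain ⟨L, hLm⟩ := Finset.card_pos.1 (Nat.one_pos.trans_eq h3.symm)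
      obtain ⟨hLL, hPL, hQL⟩ := Finset.mem_filter.1 hLm
      simp only [Finset.mem_biUnion, Finset.mem_filter, Finset.mem_erase, Finset.mem_inter]
      exact ⟨L, ⟨hLL, hPL⟩, hQP, hQL, hQD⟩
    have h3 : ∑ L ∈ Ls.filter (fun L => P ∈ pts L), ((pts L ∩ D).erase P).card ≤
        (q + 1) * (e - 1) := by
      rw [← h.card_lines P (hD hPD), ← smul_eq_mul, ← Finset.sum_const]
      refine Finset.sum_le_sum fun L hLm => ?_
      obtain ⟨hLL, hPL⟩ := Finset.mem_filter.1 hLm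
      rw [Finset.card_erase_of_mem (Finset.mem_inter.2 ⟨hPL, hPD⟩)]
      have : (pts L ∩ D).card ≤ e := by
        by_contra! hlt
        exact hP L (Finset.mem_filter.2 ⟨hLL, hlt⟩) hPL
      omega
    rw [Finset.card_erase_of_mem hPD] at h2
    have hq_e : e ≤ q := by nlinarith
    rcases e with _ | e
    · simp only [Nat.zero_sub, mul_zero, Nat.le_zero] at h3
      omega
    · simp only [Nat.add_sub_cancel] at h3
      have : D.card ≤ (q + 1) * e + 1 := by omega
      nlinarith
  · push Not at hex
    have hTe : T.card ≤ e := by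
      by_contra! hlt
      obtain ⟨S, hST, hSc⟩ := Finset.exists_subset_card_eq (Nat.succ_le_of_lt hlt)
      have h2 := h.mul_le_card_biUnion (D := D) (y := q + 1 - e) S
        (hST.trans (Finset.filter_subset _ _)) fun L hLS => by
          obtain ⟨h1, h2⟩ := Finset.mem_filter.1 (hST hLS)
          have := (hL L h1).resolve_left (by omega)
          omega
      have h3 : (S.biUnion fun L => pts L ∩ D).card ≤ D.card := Finset.card_le_card
        (Finset.biUnion_subset.2 fun L _ => Finset.inter_subset_right)
      rw [hSc] at h2
      have hq_e : e ≤ q + 1 := by nlinarith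
      zify [hq_e] at *
      nlinarith
    calc D.card ≤ (T.biUnion pts).card := Finset.card_le_card fun P hP => by
          obtain ⟨L, hLT, hPL⟩ := hex P hP
          exact Finset.mem_biUnion.2 ⟨L, hLT, hPL⟩
      _ ≤ T.card * q + 1 := h.card_biUnion_le hmeet T (Finset.filter_subset _ _)
      _ ≤ e * q + 1 := by gcongr

end IsUniformLinearSpace

section Lines

variable {F : Type} [Field F] [Fintype F] {n : ℕ}

/-- A codeword of small weight is almost constant on every line. -/
theorem exists_card_line_le {p : ℕ} [Fact p.Prime] (ι : ZMod p →+* F) {c : PGPoint F n → ZMod p}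
    (hc : c ∈ pgCode p F n) (hn : 2 ≤ n) {e : ℕ}
    (hwt : (Finset.univ.filter fun P => c P ≠ 0).card ≤
      e * ∑ i ∈ Finset.range n, Fintype.card F ^ i)
    (hpe : p * (e + 1) < Fintype.card F + 1) (heq : (e + 1) ^ 2 ≤ Fintype.card F)
    {L : Submodule F (Fin (n + 1) → F)} (hL : finrank F L = 2) :
    ∃ a, ((pgPts L).filter fun P => c P ≠ a).card ≤ e := by
  have hLcard : (pgPts L).card = Fintype.card F + 1 := by
    rw [card_pgPts hL]; simp [Finset.sum_range_succ, add_comm]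
  rcases Nat.lt_or_ge e ((pgPts L).filter fun P => c P ≠ 0).card with hm | hm
  swap
  · exact ⟨0, hm⟩
  obtain ⟨a, -, ha⟩ := Finset.exists_lt_card_fiber_of_mul_lt_card_of_maps_to
    (s := pgPts L) (t := Finset.univ) (f := c) (n := e + 1) (fun _ _ => Finset.mem_univ _)
    (by rwa [Finset.card_univ, ZMod.card, hLcard])
  refine ⟨a, ?_⟩
  have hsplit : ((pgPts L).filter fun P => c P = a).card +
      ((pgPts L).filter fun P => c P ≠ a).card = (pgPts L).card :=
    Finset.card_filter_add_card_filter_not fun P => c P = a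
  obtain ⟨m, rfl⟩ := Nat.exists_eq_add_of_le' hn
  have hcov : (pgCovers L ⊤).card = ∑ l ∈ Finset.range (m + 1), Fintype.card F ^ l :=
    card_pgCovers le_top hL (by rw [finrank_top, finrank_fin_fun]; omega)
  have hsum := sum_pgCovers (le_top : L ≤ ⊤) fun P => if c P ≠ 0 then 1 else 0
  simp only [← Finset.card_filter] at hsum
  have htot : ((pgPts ⊤ \ pgPts L).filter fun P => c P ≠ 0).card +
      ((pgPts L).filter fun P => c P ≠ 0).card = (Finset.univ.filter fun P => c P ≠ 0).card := by
    rw [← Finset.card_union_of_disjoint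
      (Finset.disjoint_filter_filter Finset.sdiff_disjoint), ← Finset.filter_union,
      Finset.sdiff_union_of_subset (pgPts_subset le_top)]
    congr 2
    ext P
    simp
  have hkey : (pgCovers L ⊤).card *
      (Fintype.card F * ((pgPts L).filter fun P => c P ≠ a).card) ≤ (pgCovers L ⊤).card *
      (((pgPts L).filter fun P => c P ≠ a).card * ((pgPts L).filter fun P => c P ≠ a).card) +
        ((pgPts ⊤ \ pgPts L).filter fun P => c P ≠ 0).card := by
    have h := Finset.sum_le_sum fun π hπ => plane_line_bound ι hc hL (π := π) hπ a (by omega)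
    rwa [Finset.sum_add_distrib, Finset.sum_const, Finset.sum_const, smul_eq_mul, smul_eq_mul,
      hsum] at h
  rw [geom_sum_succ, ← hcov] at hwt
  rw [hLcard] at hsplit
  generalize (pgCovers L ⊤).card = Θ at *
  generalize ((pgPts L).filter fun P => c P ≠ 0).card = w at *
  generalize ((pgPts ⊤ \ pgPts L).filter fun P => c P ≠ 0).card = W at *
  generalize (Finset.univ.filter fun P => c P ≠ 0).card = W' at *
  generalize ((pgPts L).filter fun P => c P ≠ a).card = s at *
  generalize Fintype.card F = q at *
  by_contra! hes
  have h1 : Θ * (q * s) < Θ * (s * s + e * q) := by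
    rw [mul_add] at hwt ⊢
    have : e * (q * Θ) = Θ * (e * q) := by ring
    omega
  have h2 := Nat.lt_of_mul_lt_mul_left h1
  have h3 : s + e + 1 ≤ q := by omega
  zify at *
  nlinarith [mul_nonneg (sub_nonneg.2 hes) (sub_nonneg.2 h3)]

end Lines

section Subspaces

variable {F : Type} [Field F] [Fintype F] {n : ℕ}

/-- The lines contained in `κ`. -/
noncomputable def pgLines (κ : Submodule F (Fin (n + 1) → F)) :
    Finset (Submodule F (Fin (n + 1) → F)) :=
  Finset.univ.filter fun L => L ≤ κ ∧ finrank F L = 2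

theorem mem_pgLines {κ L : Submodule F (Fin (n + 1) → F)} :
    L ∈ pgLines κ ↔ L ≤ κ ∧ finrank F L = 2 := by simp [pgLines]

theorem isUniformLinearSpace_pgLines {κ : Submodule F (Fin (n + 1) → F)} {k : ℕ}
    (hκ : finrank F κ = k + 1) :
    IsUniformLinearSpace (pgPts κ) (pgLines κ) pgPts (Fintype.card F)
      (∑ i ∈ Finset.range k, Fintype.card F ^ i) where
  subset L hL := pgPts_subset (mem_pgLines.1 hL).1
  card_line L hL := by
    rw [card_pgPts (mem_pgLines.1 hL).2]
    simp [Finset.sum_range_succ, add_comm]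
  card_lines P hP := by
    rw [← card_pgCovers (mem_pgPts.1 hP) P.2 (by rw [hκ, add_comm])]
    congr 1
    ext L
    simp only [pgLines, pgCovers, Finset.mem_filter, Finset.mem_univ, true_and, mem_pgPts, P.2]
    tauto
  card_join P hP Q hQ hPQ := by
    have hle : ¬ Q.1 ≤ P.1 := fun h =>
      hPQ (Subtype.ext (Submodule.eq_of_le_of_finrank_eq h (by rw [P.2, Q.2])).symm)
    have h2 : finrank F ↥(P.1 ⊔ Q.1) = 2 := by rw [finrank_sup_point hle, P.2]
    rw [Finset.card_eq_one]
    refine ⟨P.1 ⊔ Q.1, ?_⟩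
    ext L
    simp only [Finset.mem_filter, mem_pgLines, mem_pgPts, Finset.mem_singleton]
    constructor
    · rintro ⟨⟨_, hL⟩, hPL, hQL⟩
      exact (Submodule.eq_of_le_of_finrank_eq (sup_le hPL hQL) (by rw [h2, hL])).symm
    · rintro rfl
      exact ⟨⟨sup_le (mem_pgPts.1 hP) (mem_pgPts.1 hQ), h2⟩, le_sup_left, le_sup_right⟩
  card_points := by rw [card_pgPts hκ, geom_sum_succ]

theorem pgPts_inter_nonempty {κ L L' : Submodule F (Fin (n + 1) → F)} (hκ : finrank F κ = 3)
    (hL : L ∈ pgLines κ) (hL' : L' ∈ pgLines κ) : (pgPts L ∩ pgPts L').Nonempty := by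
  rw [mem_pgLines] at hL hL'
  have h1 := Submodule.finrank_sup_add_finrank_inf_eq L L'
  have h2 := Submodule.finrank_mono (sup_le hL.1 hL'.1)
  obtain ⟨m, hm⟩ := Nat.exists_eq_succ_of_ne_zero (by omega : finrank F ↥(L ⊓ L') ≠ 0)
  have hpos : 0 < (pgPts (L ⊓ L')).card := by
    rw [card_pgPts hm, Finset.sum_range_succ']
    simp
  obtain ⟨P, hP⟩ := Finset.card_pos.1 hpos
  rw [mem_pgPts, le_inf_iff] at hP
  exact ⟨P, Finset.mem_inter.2 ⟨mem_pgPts.2 hP.1, mem_pgPts.2 hP.2⟩⟩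

/-- A function that is almost constant on every line of `κ` is almost constant on `κ`. -/
theorem exists_card_subspace_le {γ : Type*} [DecidableEq γ] {c : PGPoint F n → γ}
    {e k : ℕ}
    (heq : 4 * (e + 1) ^ 2 ≤ Fintype.card F) (hq : 32 ≤ Fintype.card F)
    {κ : Submodule F (Fin (n + 1) → F)} (hκ : finrank F κ = k + 1)
    (hline : ∀ L ∈ pgLines κ, ∃ a, ((pgPts L).filter fun P => c P ≠ a).card ≤ e) :
    ∃ a, (5 * Fintype.card F * ((pgPts κ).filter fun P => c P ≠ a).card ≤
        5 * Fintype.card F * (e * ∑ i ∈ Finset.range k, Fintype.card F ^ i) +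
          6 * ∑ i ∈ Finset.range k, Fintype.card F ^ i) ∧
      (k = 2 → ((pgPts κ).filter fun P => c P ≠ a).card ≤ e * Fintype.card F + 1) := by
  have hS := isUniformLinearSpace_pgLines hκ
  obtain ⟨a, ha⟩ := hS.exists_dominant c hline
  have hmeet : ∀ L ∈ pgLines κ, (pgPts L ∩ (pgPts κ).filter fun P => c P ≠ a).card ≤ e ∨
      Fintype.card F + 1 ≤ (pgPts L ∩ (pgPts κ).filter fun P => c P ≠ a).card + e := by
    intro L hL
    have hLD : pgPts L ∩ (pgPts κ).filter (fun P => c P ≠ a) =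
        (pgPts L).filter fun P => c P ≠ a := by
      ext P
      simp only [Finset.mem_inter, Finset.mem_filter]
      exact ⟨fun h => ⟨h.1, h.2.2⟩, fun h => ⟨h.1, hS.subset L hL h.1, h.2⟩⟩
    rw [hLD]
    obtain ⟨b, hb⟩ := hline L hL
    by_cases hba : b = a
    · exact Or.inl (hba ▸ hb)
    · right
      rw [← hS.card_line L hL, ← Finset.card_filter_add_card_filter_not fun P => c P = b]
      refine Nat.add_le_add (Finset.card_le_card fun P hP => ?_) hb
      rw [Finset.mem_filter] at hP ⊢
      exact ⟨hP.1, fun h => hba (hP.2.symm.trans h)⟩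
  refine ⟨a, hS.card_le_of_thin_or_thick (Finset.filter_subset _ _) heq hq
    (fun L hL => by convert hmeet L hL) ha, ?_⟩
  rintro rfl
  have hr : ∑ i ∈ Finset.range 2, Fintype.card F ^ i = Fintype.card F + 1 := by
    simp [Finset.sum_range_succ, add_comm]
  rw [hr] at hS ha
  exact hS.card_le_of_plane (fun L hL L' hL' => by convert pgPts_inter_nonempty hκ hL hL')
    (Finset.filter_subset _ _) heq hq (fun L hL => by convert hmeet L hL) ha

end Subspaces

section Parameters

theorem pgTheta_natCast (q k : ℕ) : pgTheta q k = ∑ i ∈ Finset.range (k + 1), (q : ℤ) ^ i := by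
  rw [pgTheta, show ((k : ℤ) + 1).toNat = k + 1 by omega]

variable {p h n : ℕ}

theorem two_mul_pgDelta_le_sqrt (hh : 2 ≤ h) (hn : 3 ≤ n) :
    2 * (pgDelta p h n : ℝ) ≤ Real.sqrt ((p : ℝ) ^ h) := by
  have key : ∀ x : ℝ, 0 ≤ x → ∀ m : ℤ, 1 ≤ m → 2 * ((⌊x / (2 : ℝ) ^ m⌋ : ℤ) : ℝ) ≤ x := by
    intro x hx m hm
    have h1 : (2 : ℝ) ≤ 2 ^ m := by
      simpa using zpow_le_zpow_right₀ (by norm_num : (1 : ℝ) ≤ 2) hm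
    have h2 := (Int.floor_le (x / (2 : ℝ) ^ m)).trans
      (div_le_div_of_nonneg_left hx two_pos h1)
    linarith
  unfold pgDelta
  split_ifs with h2
  · exact key _ (Real.sqrt_nonneg _) _ (by omega)
  · obtain rfl : h = 2 := by omega
    rw [Real.sqrt_sq (Nat.cast_nonneg p)]
    exact key _ (Nat.cast_nonneg p) _ (by omega)

theorem four_mul_pgDelta_sq_le (hh : 2 ≤ h) (hn : 3 ≤ n) (hΔ : 0 ≤ pgDelta p h n) :
    4 * pgDelta p h n ^ 2 ≤ (p : ℤ) ^ h := by
  have h1 := two_mul_pgDelta_le_sqrt (p := p) hh hn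
  have h2 : (0 : ℝ) ≤ pgDelta p h n := by exact_mod_cast hΔ
  have h3 := pow_le_pow_left₀ (by positivity) h1 2
  rw [Real.sq_sqrt (by positivity)] at h3
  have h4 : 4 * (pgDelta p h n : ℝ) ^ 2 ≤ (p : ℝ) ^ h := by linarith
  exact_mod_cast h4

theorem two_mul_pgDelta_le_pgDelta {k : ℕ} (hk : k < n) :
    2 * pgDelta p h n ≤ pgDelta p h k := by
  have key : ∀ x : ℝ, 0 ≤ x → ∀ m l : ℤ, l + 1 ≤ m →
      2 * ⌊x / (2 : ℝ) ^ m⌋ ≤ ⌊x / (2 : ℝ) ^ l⌋ := by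
    intro x hx m l hml
    have h1 : (2 : ℝ) ^ l * 2 ≤ 2 ^ m := by
      rw [← zpow_add_one₀ two_ne_zero]
      exact zpow_le_zpow_right₀ one_le_two hml
    have h2 := (Int.floor_le (x / (2 : ℝ) ^ m)).trans
      (div_le_div_of_nonneg_left hx (by positivity) h1)
    rw [← div_div] at h2
    rw [Int.le_floor]
    push_cast
    linarith
  unfold pgDelta
  split_ifs
  · exact key _ (Real.sqrt_nonneg _) _ _ (by omega)
  · exact key _ (Nat.cast_nonneg p) _ _ (by omega)

/-- The arithmetic showing that a proportion `e / q` of exceptional points, up to a small error, is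
within the bound that defines thick subspaces. -/
theorem card_le_of_five_mul_le {q e d : ℤ} (j : ℕ) (hq : 32 ≤ q) (he : 0 ≤ e) (heq : 12 * e ≤ q)
    (hd : 5 * q * d ≤ 5 * q * (e * ∑ i ∈ Finset.range (j + 3), q ^ i) +
      6 * ∑ i ∈ Finset.range (j + 3), q ^ i) :
    d ≤ e * q ^ (j + 2) + q ^ (j + 1) + (j + 1) * ((q - 1) * (e + 1) + 1) * q ^ j := by
  have hv : ∑ i ∈ Finset.range j, q ^ i ≤ q ^ j := by
    clear hd
    induction j with
    | zero => simp
    | succ j ih =>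
      rw [Finset.sum_range_succ, pow_succ]
      nlinarith [pow_nonneg (by linarith : 0 ≤ q) j]
  simp only [Finset.sum_range_succ, pow_succ] at hd ⊢
  have hu := pow_nonneg (by linarith : 0 ≤ q) j
  generalize q ^ j = u at *
  generalize ∑ i ∈ Finset.range j, q ^ i = v at *
  have h1 : ((q - 1) * (e + 1) + 1) * u ≤ (j + 1) * ((q - 1) * (e + 1) + 1) * u := by
    have h2 : 0 ≤ ((q - 1) * (e + 1) + 1) * u := by
      have : 0 ≤ q - 1 := by linarith
      positivity
    have h3 : 0 ≤ (j : ℤ) * (((q - 1) * (e + 1) + 1) * u) := by positivity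
    linarith
  refine le_trans ?_ (add_le_add_right h1 _)
  have hq0 : 0 < 5 * q := by linarith
  refine le_of_mul_le_mul_left (hd.trans ?_) hq0
  have h2 : e * q * v ≤ e * q * u := mul_le_mul_of_nonneg_left hv (by positivity)
  have h3 : 12 * e * (q * u) ≤ q * (q * u) := mul_le_mul_of_nonneg_right heq (by positivity)
  have h4 : 32 * (q * u) ≤ q * (q * u) := mul_le_mul_of_nonneg_right hq (by positivity)
  have h5 : 32 * u ≤ q * u := mul_le_mul_of_nonneg_right hq hu
  linarith

end Parameters

/-- Lemma: if every thin `j`-subspace of the `k`-space `κ` (for `1 ≤ j ≤ k−1`) admits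
a representation as a combination of exactly `⌈wt/θ_{j−1}⌉` different `(j−1)`-subspaces,
then `κ` is either thin or thick with respect to `c`. -/
theorem statement_6 (p h n : ℕ) (hp : p.Prime) (hh : 2 ≤ h) (hn : 3 ≤ n)
    (hq1 : 2 < h → max 32 (2 ^ (2 * n - 4)) ≤ p ^ h)
    (hq2 : h = 2 → 2 ^ (2 * n) ≤ p ^ h)
    (F : Type) [Field F] [Fintype F] (hF : Fintype.card F = p ^ h)
    (c : PGPoint F n → ZMod p) (hc : c ∈ pgCode p F n)
    (hwt : (pgWt p F n c : ℤ) ≤ pgW p h n)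
    (k : ℕ) (hk1 : 1 ≤ k) (hkn : k ≤ n - 1)
    (κ : Submodule F (Fin (n + 1) → F)) (hκdim : finrank F κ = k + 1)
    (hsub : ∀ j : ℕ, 1 ≤ j → j ≤ k - 1 →
      ∀ γ : Submodule F (Fin (n + 1) → F), finrank F γ = j + 1 → γ ≤ κ →
        (pgSecant p F n c γ : ℤ) ≤ pgW p h j →
        ∃ (δ : Fin (pgCeil (p ^ h) (pgSecant p F n c γ) ((j : ℤ) - 1)) →
              Submodule F (Fin (n + 1) → F))
          (β : Fin (pgCeil (p ^ h) (pgSecant p F n c γ) ((j : ℤ) - 1)) → ZMod p),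
          Function.Injective δ ∧ (∀ i, δ i ≤ γ ∧ finrank F (δ i) = j) ∧
          (∀ i, β i ≠ 0) ∧
          ∀ P : PGPoint F n, P.1 ≤ γ → c P = ∑ i, β i * pgInd p F n (δ i) P) :
    (pgSecant p F n c κ : ℤ) ≤ pgW p h k ∨ pgU p h n k ≤ (pgSecant p F n c κ : ℤ) := by
  have : Fact p.Prime := ⟨hp⟩
  have : CharP F p := charP_of_card_eq_prime_pow hF
  have hpow : p ^ 2 ≤ p ^ h := Nat.pow_le_pow_right hp.pos hh
  have hq : 32 ≤ p ^ h := by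
    rcases hh.lt_or_eq with h2 | h2
    · exact (le_max_left _ _).trans (hq1 h2)
    · exact (Nat.pow_le_pow_right two_pos (by omega : 5 ≤ 2 * n)).trans (hq2 h2.symm)
  have hΔ1 : 1 ≤ pgDelta p h n := by
    have h0 : 0 < pgTheta (p ^ h) ((n : ℤ) - 1) := by
      rw [← Nat.cast_pred (by omega : 0 < n), pgTheta_natCast, Finset.sum_range_succ']
      positivity
    have h1 : 0 ≤ (pgDelta p h n - 1) * pgTheta (p ^ h) ((n : ℤ) - 1) :=
      (Nat.cast_nonneg _).trans hwt
    linarith [nonneg_of_mul_nonneg_left h1 h0]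
  have hΔq := four_mul_pgDelta_sq_le (p := p) hh hn (by linarith)
  have hΔk := two_mul_pgDelta_le_pgDelta (p := p) (h := h) (by omega : k < n)
  obtain ⟨e, he⟩ := Int.eq_ofNat_of_zero_le (by linarith : 0 ≤ pgDelta p h n - 1)
  have hΔ : pgDelta p h n = e + 1 := by linarith
  rw [hΔ] at hΔq hΔk
  have heq : 4 * (e + 1) ^ 2 ≤ Fintype.card F := by
    rw [hF]
    exact_mod_cast hΔq
  have hpe : p * (e + 1) < Fintype.card F + 1 := by
    rw [hF] at heq ⊢
    have : 4 * (p * (e + 1)) ≤ 2 * p ^ 2 + 2 * (e + 1) ^ 2 := by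
      nlinarith [two_mul_le_add_sq p (e + 1)]
    nlinarith
  have hwt' : (Finset.univ.filter fun P => c P ≠ 0).card ≤
      e * ∑ i ∈ Finset.range n, Fintype.card F ^ i := by
    rw [pgW, he, ← Nat.cast_pred (by omega : 0 < n), pgTheta_natCast,
      Nat.sub_add_cancel (by omega : 1 ≤ n), pgWt] at hwt
    rw [hF, ← Set.ncard_coe_finset]
    simp only [Finset.coe_filter, Finset.mem_univ, true_and]
    exact_mod_cast hwt
  have hline : ∀ L : Submodule F (Fin (n + 1) → F), finrank F L = 2 →
      ∃ a, ((pgPts L).filter fun P => c P ≠ a).card ≤ e := fun L hL =>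
    exists_card_line_le (ZMod.castHom dvd_rfl F) hc (by omega) hwt' hpe (by omega) hL
  obtain ⟨a, hdW, hdU⟩ : ∃ a, (((pgPts κ).filter fun P => c P ≠ a).card : ℤ) ≤ pgW p h k ∧
      (((pgPts κ).filter fun P => c P ≠ a).card : ℤ) + pgU p h n k ≤ pgTheta (p ^ h) k := by
    have hq' : (32 : ℤ) ≤ ((p ^ h : ℕ) : ℤ) := by exact_mod_cast hq
    have he12 : 12 * (e : ℤ) ≤ ((p ^ h : ℕ) : ℤ) := by
      push_cast at hq' ⊢
      rcases lt_or_ge (e : ℤ) 3 with h3 | h3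
      · linarith
      · nlinarith
    have hW : ∀ d : ℤ, d ≤ (e + 1) * pgTheta (p ^ h) ((k - 1 : ℕ) : ℤ) → d ≤ pgW p h k := by
      intro d hd
      rw [pgW, ← Nat.cast_pred hk1]
      refine hd.trans (mul_le_mul_of_nonneg_right (by linarith) ?_)
      rw [pgTheta_natCast]
      positivity
    rcases Nat.lt_or_ge 1 k with hk | hk
    swap
    · obtain rfl : k = 1 := by omega
      obtain ⟨a, ha⟩ := hline κ hκdim
      have ha' : (((pgPts κ).filter fun P => c P ≠ a).card : ℤ) ≤ e := by exact_mod_cast ha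
      refine ⟨a, hW _ ?_, ?_⟩
      · simp [pgTheta]
        linarith
      · simp only [pgU, hΔ]
        simp [pgTheta, pgQpow, Finset.sum_range_succ]
        linarith
    obtain ⟨a, ha, ha2⟩ := exists_card_subspace_le (c := c) heq (hF ▸ hq) hκdim
      fun L hL => hline L (mem_pgLines.1 hL).2
    rw [hF] at ha ha2
    have ha' : 5 * ((p ^ h : ℕ) : ℤ) * ((pgPts κ).filter fun P => c P ≠ a).card ≤
        5 * ((p ^ h : ℕ) : ℤ) * (e * ∑ i ∈ Finset.range k, ((p ^ h : ℕ) : ℤ) ^ i) +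
          6 * ∑ i ∈ Finset.range k, ((p ^ h : ℕ) : ℤ) ^ i := by exact_mod_cast ha
    refine ⟨a, hW _ ?_, ?_⟩
    · rw [pgTheta_natCast, Nat.sub_add_cancel hk1]
      have hr : (0 : ℤ) ≤ ∑ i ∈ Finset.range k, ((p ^ h : ℕ) : ℤ) ^ i := by positivity
      refine le_of_mul_le_mul_left (ha'.trans ?_) (by linarith : 0 < 5 * ((p ^ h : ℕ) : ℤ))
      linarith [mul_le_mul_of_nonneg_right hq' hr]
    · obtain ⟨j, rfl⟩ := Nat.exists_eq_add_of_le' hk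
      rcases j with _ | j
      · have ha2' : (((pgPts κ).filter fun P => c P ≠ a).card : ℤ) ≤ e * (p ^ h : ℕ) + 1 := by
          exact_mod_cast ha2 rfl
        simp only [pgU, hΔ]
        simp [pgTheta, pgQpow, Finset.sum_range_succ] at ha2' ⊢
        linarith
      · have hd := card_le_of_five_mul_le j hq' (Nat.cast_nonneg e) he12 ha'
        have h1 : pgTheta (p ^ h) ((j + 1 + 2 : ℕ) : ℤ) = pgTheta (p ^ h) j +
            ((p ^ h : ℕ) : ℤ) ^ (j + 1) + ((p ^ h : ℕ) : ℤ) ^ (j + 2) +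
              ((p ^ h : ℕ) : ℤ) ^ (j + 3) := by
          simp only [pgTheta_natCast, Finset.sum_range_succ]
        have h2 : ∀ i : ℕ, pgQpow (p ^ h) i = ((p ^ h : ℕ) : ℤ) ^ i := fun i => by
          simp [pgQpow]
        rw [pgU, h1, hΔ, show ((j + 1 + 2 : ℕ) : ℤ) - 1 = (j + 2 : ℕ) by push_cast; ring,
          show ((j + 1 + 2 : ℕ) : ℤ) - 3 = j by push_cast; ring, h2, h2, h2]
        push_cast at hd ⊢
        linarith
  have hsec : pgSecant p F n c κ = ((pgPts κ).filter fun P => c P ≠ 0).card := by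
    rw [pgSecant, ← Set.ncard_coe_finset]
    congr 1
    ext P
    simp [and_comm]
  rw [hsec]
  by_cases ha : a = 0
  · exact Or.inl (ha ▸ hdW)
  · right
    have h1 : pgTheta (p ^ h) k = (pgPts κ).card := by
      rw [pgTheta_natCast, card_pgPts hκdim, hF]
      push_cast
      rfl
    have h2 : (pgPts κ).card ≤ ((pgPts κ).filter fun P => c P ≠ 0).card +
        ((pgPts κ).filter fun P => c P ≠ a).card := by
      refine (Finset.card_le_card fun P hP => ?_).trans (Finset.card_union_le _ _)
      simp only [Finset.mem_union, Finset.mem_filter, hP, true_and]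
      by_contra! h3
      exact ha (h3.2.symm.trans h3.1)
    zify at h2
    linarith
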